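/- arXiv:2002.06365 — 2 statements merged into one kernel-verified Lean document; each statement's English description precedes it below -/
import Mathlib

section
/- Let A be a commutative ℂ-algebra, M an A-module, D : A → M a derivation, p a seminorm on A with p(ab) ≤ p(a)p(b) for all a,b ∈ A, and p' a seminorm on M with p'(a•x) ≤ p(a)p'(x) for all a ∈ A, x ∈ M. Define q_D on U = A ⊕ M by q_D((a,x)) = p(a) + p'(D(a) − x). Then q_D is submultiplicative: q_D(u·v) ≤ q_D(u)·q_D(v) for all u, v ∈ U. -/
/-- If `p` is a submultiplicative seminorm on the commutative ℂ-algebra `A`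
and `p'` a seminorm on the `A`-module `M` with `p' (a • x) ≤ p a * p' x`, and `D : A → M`
is a derivation, then `q_D (a, x) = p a + p' (D a - x)` is a submultiplicative seminorm
on the square-zero extension `U = TrivSqZeroExt A M`. -/
theorem stmt_1 {A M : Type*} [CommRing A] [Algebra ℂ A]
    [AddCommGroup M] [Module ℂ M] [Module A M] [Module Aᵐᵒᵖ M] [IsCentralScalar A M]
    (D : A →ₗ[ℂ] M) (hD : ∀ a b : A, D (a * b) = a • D b + b • D a)
    (p : Seminorm ℂ A) (hp : ∀ a b : A, p (a * b) ≤ p a * p b)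
    (p' : Seminorm ℂ M) (hp' : ∀ (a : A) (x : M), p' (a • x) ≤ p a * p' x)
    (qD : TrivSqZeroExt A M → ℝ)
    (hqD : ∀ u : TrivSqZeroExt A M, qD u = p u.fst + p' (D u.fst - u.snd)) :
    ∀ u v : TrivSqZeroExt A M, qD (u * v) ≤ qD u * qD v := by
  intro u v
  have key : D (u * v).fst - (u * v).snd
      = u.fst • (D v.fst - v.snd) + v.fst • (D u.fst - u.snd) := by
    rw [TrivSqZeroExt.fst_mul, TrivSqZeroExt.snd_mul, hD, op_smul_eq_smul, smul_sub, smul_sub]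
    abel
  have hadd := map_add_le_add p' (u.fst • (D v.fst - v.snd)) (v.fst • (D u.fst - u.snd))
  have hu := hp' u.fst (D v.fst - v.snd)
  have hv := hp' v.fst (D u.fst - u.snd)
  have huv := hp u.fst v.fst
  have hnonneg := mul_nonneg (apply_nonneg p' (D u.fst - u.snd)) (apply_nonneg p' (D v.fst - v.snd))
  rw [hqD, hqD, hqD, key, TrivSqZeroExt.fst_mul]
  linarith
end

section
/- Let A be a commutative ℂ-algebra, M an A-module, D : A → M a derivation, (p_k)_{k∈ℕ} a family of seminorms on A and (p'_k)_{k∈ℕ} a family of seminorms on M which is separating (p'_k(x) = 0 for all k implies x = 0). Define on U = A ⊕ M the seminorms q_k((a,x)) = p_k(a) + p'_k(x) and q_{k,D}((a,x)) = p_k(a) + p'_k(D(a) − x). Suppose D ≠ 0 and D vanishes on a subset S ⊆ A that is dense in A for the topology induced by the family (p_k). Then the family (q_{k,D}) is not dominated by the family (q_k): it is NOT the case that for every m ∈ ℕ there exist n ∈ ℕ and c > 0 with q_{m,D}(u) ≤ c·q_n(u) for all u ∈ U; in particular the two families induce inequivalent topologies on U. -/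
/-- Let `A` carry the topology of the seminorm family `(p_k)`, let `(p'_k)`
be a separating seminorm family on `M`, and let `D : A → M` be a nonzero derivation that
vanishes on a dense subset `S` of `A`. Then on `U = TrivSqZeroExt A M` the family
`q_{k,D} (a, x) = p_k a + p'_k (D a - x)` is not dominated by the family
`q_k (a, x) = p_k a + p'_k x`; in particular the two families give inequivalent
topologies on `U`. -/
theorem stmt_14 {A M : Type*} [CommRing A] [Algebra ℂ A]
    [AddCommGroup M] [Module ℂ M] [Module A M]
    [TopologicalSpace A]
    (p : SeminormFamily ℂ A ℕ) (hp : WithSeminorms p)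
    (p' : ℕ → Seminorm ℂ M) (hsep : ∀ x : M, (∀ k : ℕ, p' k x = 0) → x = 0)
    (D : A →ₗ[ℂ] M) (hD : ∀ a b : A, D (a * b) = a • D b + b • D a)
    (hDne : D ≠ 0)
    (S : Set A) (hdense : Dense S) (hvan : ∀ s ∈ S, D s = 0)
    (q qD : ℕ → TrivSqZeroExt A M → ℝ)
    (hq : ∀ (k : ℕ) (u : TrivSqZeroExt A M), q k u = p k u.fst + p' k u.snd)
    (hqD : ∀ (k : ℕ) (u : TrivSqZeroExt A M),
      qD k u = p k u.fst + p' k (D u.fst - u.snd)) :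
    ¬ ∀ m : ℕ, ∃ n : ℕ, ∃ c : ℝ, 0 < c ∧ ∀ u : TrivSqZeroExt A M, qD m u ≤ c * q n u := by
  intro h
  apply hDne
  ext a
  refine hsep _ fun m => ?_
  obtain ⟨n, c, hc, hle⟩ := h m
  have hbound (b : A) : p' m (D b) ≤ c * p n b := by
    have hb := hle (TrivSqZeroExt.inl b)
    rw [hq, hqD] at hb
    simp only [TrivSqZeroExt.fst_inl, TrivSqZeroExt.snd_inl, sub_zero, map_zero, add_zero] at hb
    linarith [apply_nonneg (p m) b]
  refine le_antisymm (le_of_forall_pos_le_add fun ε hε => ?_) (apply_nonneg _ _)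
  have := hp.topologicalAddGroup
  have hcont : Continuous fun s : A => p n (a - s) :=
    (hp.continuous_seminorm n).comp (continuous_const.sub continuous_id)
  obtain ⟨s, hs, hsS⟩ := hdense.inter_open_nonempty {s | p n (a - s) < ε / c}
    (isOpen_lt hcont continuous_const) ⟨a, by simpa using div_pos hε hc⟩
  have hDs : D (a - s) = D a := by rw [map_sub, hvan s hsS, sub_zero]
  calc p' m (D a) = p' m (D (a - s)) := by rw [hDs]
    _ ≤ c * p n (a - s) := hbound _
    _ ≤ c * (ε / c) := mul_le_mul_of_nonneg_left (le_of_lt hs) hc.le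
    _ = 0 + ε := by field_simp; ring
end
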